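/- Assume ⊢^R is contrapositive for assumptions. If some preferred extension of the sequent-based ABA-framework contains an argument A' ⟨ Γ ⇒ φ with A' ⊆ A and Γ ⊆ S, then φ ∈ CN(S ∪ T) for some T ∈ MCS(S,A). -/

import Mathlib

/-- A rule `φ₁,…,φₙ → φ` of a deductive system: premises and a conclusion. -/
abbrev Rule (F : Type) := List F × F

/-- Deducibility `Γ ⊢^R φ`: chaining rules of `R` from members of `Γ`. -/
inductive Ded {F : Type} (R : Set (Rule F)) (Γ : Set F) : F → Prop
  | mem {φ : F} : φ ∈ Γ → Ded R Γ φ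
  | app {l : List F} {φ : F} : (l, φ) ∈ R → (∀ ψ ∈ l, Ded R Γ ψ) → Ded R Γ φ

/-- Derivability of assumptive sequents `A' ⟨ Γ ⇒ Δ` in the calculus `R_⇒`:
the sequents `μ(r)` for `r ∈ R`, the identity axiom, the two cut rules, and the
rules `AS_ABA` moving a formula of the assumption set `AS` between the
assumption component and the left-hand side of `⇒`. -/
inductive SeqDer {F : Type} [DecidableEq F] (R : Set (Rule F)) (AS : Set F) :
    Finset F → Finset F → Finset F → Prop
  | id (φ : F) : SeqDer R AS ∅ {φ} {φ}
  | mu {l : List F} {φ : F} : (l, φ) ∈ R → SeqDer R AS ∅ l.toFinset {φ}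
  | cutLhs {A₁ A₂ Γ₁ Γ₂ Δ₁ Δ₂ : Finset F} {φ : F} :
      SeqDer R AS A₁ Γ₁ (insert φ Δ₁) → SeqDer R AS A₂ (insert φ Γ₂) Δ₂ →
      SeqDer R AS (A₁ ∪ A₂) (Γ₁ ∪ Γ₂) (Δ₁ ∪ Δ₂)
  | cutAss {A₁ A₂ Γ₁ Γ₂ Δ₁ Δ₂ : Finset F} {φ : F} :
      SeqDer R AS A₁ Γ₁ (insert φ Δ₁) → SeqDer R AS (insert φ A₂) Γ₂ Δ₂ →
      SeqDer R AS (A₁ ∪ A₂) (Γ₁ ∪ Γ₂) (Δ₁ ∪ Δ₂)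
  | toAss {A' Γ Δ : Finset F} {φ : F} :
      φ ∈ AS → SeqDer R AS A' (insert φ Γ) Δ → SeqDer R AS (insert φ A') Γ Δ
  | toLhs {A' Γ Δ : Finset F} {φ : F} :
      φ ∈ AS → SeqDer R AS (insert φ A') Γ Δ → SeqDer R AS A' (insert φ Γ) Δ

/-- An argument: an assumption component, a support (strict premises) and a conclusion. -/
structure Argu (F : Type) where
  ass : Finset F
  supp : Finset F
  concl : F

/-- `a` is an ABA-argument based on `S` and `A`: a deduction `ass(a) ∪ supp(a) ⊢^R conc(a)`
with finite `ass(a) ⊆ A` and finite `supp(a) ⊆ S`. -/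
def IsABAArg {F : Type} (R : Set (Rule F)) (S A : Set F) (a : Argu F) : Prop :=
  ↑a.ass ⊆ A ∧ ↑a.supp ⊆ S ∧ Ded R (↑a.ass ∪ ↑a.supp) a.concl

/-- `a` is an assumptive sequent argument based on `S` and `A`: a sequent
`ass(a) ⟨ supp(a) ⇒ conc(a)` derivable in `R_⇒`, with `ass(a) ⊆ A` and `supp(a) ⊆ S`. -/
def IsSeqArg {F : Type} [DecidableEq F] (R : Set (Rule F)) (S A : Set F) (a : Argu F) : Prop :=
  ↑a.ass ⊆ A ∧ ↑a.supp ⊆ S ∧ SeqDer R A a.ass a.supp {a.concl}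

/-- `a` attacks `b` iff the conclusion of `a` is the contrary of some assumption of `b`
(this is the ABA attack, and also the sequent-based `AT_ABA` attack). -/
def Attacks {F : Type} (contrary : F → F) (a b : Argu F) : Prop :=
  ∃ ψ ∈ b.ass, a.concl = contrary ψ

/-- `E` is conflict-free: a set of arguments of the framework no member of which attacks a member. -/
def ConflictFree {α : Type} (Args : Set α) (att : α → α → Prop) (E : Set α) : Prop :=
  E ⊆ Args ∧ ∀ a ∈ E, ∀ b ∈ E, ¬ att a b

/-- `E` defends `a`: `E` attacks every attacker of `a`. -/
def Defends {α : Type} (Args : Set α) (att : α → α → Prop) (E : Set α) (a : α) : Prop :=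
  ∀ b ∈ Args, att b a → ∃ c ∈ E, att c b

/-- `E` is admissible: conflict-free and defending all of its elements. -/
def Admissible {α : Type} (Args : Set α) (att : α → α → Prop) (E : Set α) : Prop :=
  ConflictFree Args att E ∧ ∀ a ∈ E, Defends Args att E a

/-- A complete extension: an admissible set containing every argument it defends. -/
def CompleteExt {α : Type} (Args : Set α) (att : α → α → Prop) (E : Set α) : Prop :=
  Admissible Args att E ∧ ∀ a ∈ Args, Defends Args att E a → a ∈ E

/-- The grounded extension: the ⊆-minimal complete extension. -/
def GroundedExt {α : Type} (Args : Set α) (att : α → α → Prop) (E : Set α) : Prop :=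
  CompleteExt Args att E ∧ ∀ E', CompleteExt Args att E' → E ⊆ E'

/-- A preferred extension: a ⊆-maximal complete extension. -/
def PreferredExt {α : Type} (Args : Set α) (att : α → α → Prop) (E : Set α) : Prop :=
  CompleteExt Args att E ∧ ∀ E', CompleteExt Args att E' → E ⊆ E' → E' = E

/-- A set `A'` of assumptions is consistent iff there is no `φ ∈ A'` with
`A'' ∪ Γ ⊢^R φ̄` for some `A'' ⊆ A'` and `Γ ⊆ S`. -/
def ConsistentSet {F : Type} (R : Set (Rule F)) (contrary : F → F) (S : Set F)
    (A' : Set F) : Prop :=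
  ¬ ∃ φ ∈ A', ∃ A'' ⊆ A', ∃ Γ ⊆ S, Ded R (A'' ∪ Γ) (contrary φ)

/-- `MCS(S,A)`: the set of ⊆-maximal consistent subsets of `A`. -/
def MCS {F : Type} (R : Set (Rule F)) (contrary : F → F) (S A : Set F) : Set (Set F) :=
  {T | T ⊆ A ∧ ConsistentSet R contrary S T ∧
    ∀ T', T ⊆ T' → T' ⊆ A → ConsistentSet R contrary S T' → T' = T}

/-- `CN(T) = {φ | Γ ⊢^R φ for some Γ ⊆ T}`. -/
def CN {F : Type} (R : Set (Rule F)) (T : Set F) : Set F :=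
  {φ | ∃ Γ ⊆ T, Ded R Γ φ}

/-- `⊢^R` is contrapositive for assumptions: for all `φ, ψ` in an assumption set `A'`
and `Γ ⊆ S`, `A' ∪ Γ ⊢^R ψ̄` iff `(A' \ {φ}) ∪ {ψ} ∪ Γ ⊢^R φ̄`. -/
def Contrapositive {F : Type} (R : Set (Rule F)) (contrary : F → F) (S A : Set F) : Prop :=
  ∀ A' ⊆ A, ∀ Γ ⊆ S, ∀ φ ∈ A', ∀ ψ ∈ A',
    (Ded R (A' ∪ Γ) (contrary ψ) ↔ Ded R ((A' \ {φ}) ∪ {ψ} ∪ Γ) (contrary φ))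

theorem Ded.mono {F : Type} {R : Set (Rule F)} {Γ Γ' : Set F} (h : Γ ⊆ Γ') {φ : F}
    (hd : Ded R Γ φ) : Ded R Γ' φ := by
  induction hd with
  | mem hm => exact .mem (h hm)
  | app hr _ ih => exact .app hr ih

theorem Ded.trans {F : Type} {R : Set (Rule F)} {Γ Γ' : Set F}
    (h : ∀ ψ ∈ Γ, Ded R Γ' ψ) {φ : F} (hd : Ded R Γ φ) : Ded R Γ' φ := by
  induction hd with
  | mem hm => exact h _ hm
  | app hr _ ih => exact .app hr ih

/-- Soundness of the calculus: the premises of a derivable sequent deduce each formula on its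
right-hand side. -/
theorem SeqDer.ded {F : Type} [DecidableEq F] {R : Set (Rule F)} {A : Set F}
    {B Γ Δ : Finset F} (h : SeqDer R A B Γ Δ) : ∀ δ ∈ Δ, Ded R (↑B ∪ ↑Γ) δ := by
  induction h with
  | id φ => intro δ hδ; exact .mem (by simpa using hδ)
  | @mu l φ hr =>
    intro δ hδ
    obtain rfl := Finset.mem_singleton.mp hδ
    exact .app hr fun ψ hψ => .mem (by simpa using hψ)
  | @cutLhs A₁ A₂ Γ₁ Γ₂ Δ₁ Δ₂ φ _ _ ih₁ ih₂ =>
    intro δ hδ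
    have h₁ : ∀ χ ∈ insert φ Δ₁, Ded R (↑(A₁ ∪ A₂) ∪ ↑(Γ₁ ∪ Γ₂)) χ := fun χ hχ =>
      (ih₁ χ hχ).mono (by intro x; simp; tauto)
    rcases Finset.mem_union.mp hδ with hδ | hδ
    · exact h₁ δ (Finset.mem_insert_of_mem hδ)
    · refine (ih₂ δ hδ).trans fun ψ hψ => ?_
      by_cases hψφ : ψ = φ
      · exact h₁ ψ (by simp [hψφ])
      · exact .mem (by simp at hψ ⊢; tauto)
  | @cutAss A₁ A₂ Γ₁ Γ₂ Δ₁ Δ₂ φ _ _ ih₁ ih₂ =>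
    intro δ hδ
    have h₁ : ∀ χ ∈ insert φ Δ₁, Ded R (↑(A₁ ∪ A₂) ∪ ↑(Γ₁ ∪ Γ₂)) χ := fun χ hχ =>
      (ih₁ χ hχ).mono (by intro x; simp; tauto)
    rcases Finset.mem_union.mp hδ with hδ | hδ
    · exact h₁ δ (Finset.mem_insert_of_mem hδ)
    · refine (ih₂ δ hδ).trans fun ψ hψ => ?_
      by_cases hψφ : ψ = φ
      · exact h₁ ψ (by simp [hψφ])
      · exact .mem (by simp at hψ ⊢; tauto)
  | toAss _ _ ih => exact fun δ hδ => (ih δ hδ).mono (by intro x; simp; tauto)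
  | toLhs _ _ ih => exact fun δ hδ => (ih δ hδ).mono (by intro x; simp; tauto)

/-- Cutting away a list of left-hand formulas, each derivable from parts of `T` and `S`. -/
theorem SeqDer.exists_cut_list {F : Type} [DecidableEq F] {R : Set (Rule F)} {S A T : Set F}
    {φ : F} (l : List F) {B Γ : Finset F} (hB : ↑B ⊆ T) (hΓ : ↑Γ ⊆ S)
    (h : SeqDer R A B (l.toFinset ∪ Γ) {φ})
    (hl : ∀ ψ ∈ l, ∃ B Γ : Finset F, ↑B ⊆ T ∧ ↑Γ ⊆ S ∧ SeqDer R A B Γ {ψ}) :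
    ∃ B Γ : Finset F, ↑B ⊆ T ∧ ↑Γ ⊆ S ∧ SeqDer R A B Γ {φ} := by
  induction l generalizing B Γ with
  | nil => exact ⟨B, Γ, hB, hΓ, by simpa using h⟩
  | cons ψ l ih =>
    obtain ⟨B₁, Γ₁, hB₁, hΓ₁, h₁⟩ := hl ψ (by simp)
    refine ih (B := B₁ ∪ B) (Γ := Γ₁ ∪ Γ) (by simp [hB, hB₁]) (by simp [hΓ, hΓ₁]) ?_
      fun χ hχ => hl χ (by simp [hχ])
    rw [List.toFinset_cons, Finset.insert_union] at h
    have h₂ := SeqDer.cutLhs (Δ₁ := ∅) h₁ h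
    rwa [Finset.empty_union, Finset.union_left_comm] at h₂

/-- Completeness of the calculus: a deduction from assumptions `T` and strict premises `S` yields
a derivable sequent with finite premises. -/
theorem Ded.exists_seqDer {F : Type} [DecidableEq F] {R : Set (Rule F)} {S A T : Set F}
    (hT : T ⊆ A) {φ : F} (h : Ded R (T ∪ S) φ) :
    ∃ B Γ : Finset F, ↑B ⊆ T ∧ ↑Γ ⊆ S ∧ SeqDer R A B Γ {φ} := by
  induction h with
  | @mem φ hm =>
    rcases hm with hm | hm
    · exact ⟨{φ}, ∅, by simpa using hm, by simp, SeqDer.toAss (A' := ∅) (hT hm) (SeqDer.id φ)⟩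
    · exact ⟨∅, {φ}, by simp, by simpa using hm, SeqDer.id φ⟩
  | @app l φ hr _ ih =>
    exact SeqDer.exists_cut_list l (B := ∅) (Γ := ∅) (by simp) (by simp)
      (by simpa using SeqDer.mu hr) ih

theorem consistentSet_iff {F : Type} {R : Set (Rule F)} {contrary : F → F} {S T : Set F} :
    ConsistentSet R contrary S T ↔ ∀ φ ∈ T, ¬ Ded R (T ∪ S) (contrary φ) := by
  constructor
  · exact fun h φ hφ hd => h ⟨φ, hφ, T, subset_rfl, S, subset_rfl, hd⟩
  · rintro h ⟨φ, hφ, B, hB, Γ, hΓ, hd⟩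
    exact h φ hφ (hd.mono (Set.union_subset_union hB hΓ))

theorem ConsistentSet.sUnion {F : Type} [DecidableEq F] {R : Set (Rule F)} {contrary : F → F}
    {S : Set F} {c : Set (Set F)} (hc : IsChain (· ⊆ ·) c) (hne : c.Nonempty)
    (h : ∀ T ∈ c, ConsistentSet R contrary S T) : ConsistentSet R contrary S (⋃₀ c) := by
  rw [consistentSet_iff]
  rintro φ ⟨T₁, hT₁, hφ⟩ hd
  obtain ⟨B, Γ, hB, hΓ, hs⟩ := hd.exists_seqDer subset_rfl
  obtain ⟨T₂, hT₂, hB₂⟩ := DirectedOn.exists_mem_subset_of_finset_subset_biUnion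
    (f := id) hne hc.directedOn (s := B) (by simpa [Set.sUnion_eq_biUnion] using hB)
  obtain ⟨T, hT, hT₁T, hT₂T⟩ := hc.directedOn T₁ hT₁ T₂ hT₂
  exact h T hT ⟨φ, hT₁T hφ, B, hB₂.trans hT₂T, Γ, hΓ, hs.ded _ (by simp)⟩

/-- Every consistent set of assumptions extends to a maximal consistent one. -/
theorem ConsistentSet.exists_mem_MCS {F : Type} [DecidableEq F] {R : Set (Rule F)}
    {contrary : F → F} {S A B : Set F} (hB : B ⊆ A) (h : ConsistentSet R contrary S B) :
    ∃ T ∈ MCS R contrary S A, B ⊆ T := by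
  obtain ⟨T, hBT, hT⟩ := zorn_subset_nonempty {T | T ⊆ A ∧ ConsistentSet R contrary S T}
    (fun c hcs hc hne => ⟨⋃₀ c, ⟨Set.sUnion_subset fun T hT => (hcs hT).1,
      ConsistentSet.sUnion hc hne fun T hT => (hcs hT).2⟩,
      fun T hT => Set.subset_sUnion_of_mem hT⟩) B ⟨hB, h⟩
  exact ⟨T, ⟨hT.prop.1, hT.prop.2, fun T' hTT' hT'A hT' =>
    (hT.eq_of_subset ⟨hT'A, hT'⟩ hTT').symm⟩, hBT⟩

/-- The assumptions of a member of an admissible set are consistent. -/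
theorem Admissible.consistentSet_ass {F : Type} [DecidableEq F] {R : Set (Rule F)}
    {contrary : F → F} {S A : Set F} {E : Set (Argu F)}
    (hE : Admissible {a | IsSeqArg R S A a} (Attacks contrary) E) {a : Argu F} (ha : a ∈ E) :
    ConsistentSet R contrary S ↑a.ass := by
  rw [consistentSet_iff]
  intro φ hφ hd
  have haA : ↑a.ass ⊆ A := (hE.1.1 ha).1
  obtain ⟨B, Γ, hB, hΓ, hs⟩ := hd.exists_seqDer haA
  obtain ⟨c, hc, ψ, hψ, hcψ⟩ :=
    hE.2 a ha ⟨B, Γ, contrary φ⟩ ⟨hB.trans haA, hΓ, hs⟩ ⟨φ, hφ, rfl⟩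
  exact hE.1.2 c hc a ha ⟨ψ, hB hψ, hcψ⟩


/-- Assuming `⊢^R` is contrapositive for assumptions: if some preferred extension of
the sequent-based ABA-framework contains an argument `A' ⟨ Γ ⇒ φ` with `A' ⊆ A` and
`Γ ⊆ S`, then `φ ∈ CN(S ∪ T)` for some `T ∈ MCS(S,A)`. -/
theorem stmt15 {F V : Type} [DecidableEq F]
    (R : Set (Rule F)) (S A : Set F) (contrary : F → F) (atoms : F → Set V)
    (hA : A.Nonempty) (hSA : S ∩ A = ∅)
    (hNT : ∀ φ : F, (∀ s ∈ S, Disjoint (atoms φ) (atoms s)) → ¬ Ded R S φ)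
    (hcp : Contrapositive R contrary S A) (φ : F)
    (h : ∃ E, PreferredExt {a | IsSeqArg R S A a} (Attacks contrary) E ∧
        ∃ a ∈ E, (a.ass : Set F) ⊆ A ∧ (a.supp : Set F) ⊆ S ∧ a.concl = φ) :
    ∃ T ∈ MCS R contrary S A, φ ∈ CN R (S ∪ T) := by
  obtain ⟨E, hE, a, ha, haA, haS, rfl⟩ := h
  have hadm := hE.1.1
  obtain ⟨T, hT, haT⟩ := (hadm.consistentSet_ass ha).exists_mem_MCS haA
  refine ⟨T, hT, ↑a.ass ∪ ↑a.supp, ?_, (hadm.1.1 ha).2.2.ded _ (by simp)⟩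
  exact Set.union_subset (haT.trans Set.subset_union_right) (haS.trans Set.subset_union_left)
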